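/- Let K be an algebraically closed field of characteristic zero, d ≥ 4, 0 ≤ δ ≤ d, and A = K⟨v1,…,vd⟩ the free associative K-algebra. Let 1_{δ,d} = (1,…,1,−1,…,−1) ∈ K^d with δ entries equal to 1 followed by d−δ entries equal to −1. Then every K-linear map ⟪-,-⟫ : A⊗A → A⊗A satisfying the Leibniz rules with ⟪v_i,v_i⟫ = 0 for all 1≤i≤d; ⟪v_i,v_j⟫ = v_i⊗v_j − v_j⊗v_i and ⟪v_j,v_i⟫ = 0 for 1≤i<j≤δ; ⟪v_i,v_k⟫ = 1⊗(v_iv_k) − (v_kv_i)⊗1 and ⟪v_k,v_i⟫ = 0 for 1≤i≤δ<k≤d; ⟪v_k,v_l⟫ = −v_k⊗v_l + v_l⊗v_k and ⟪v_l,v_k⟫ = 0 for δ<k<l≤d, is a mixed double Poisson algebra structure on A of weight 1_{δ,d}; in particular, it is a modified double Poisson bracket on A. -/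

import Mathlib

open TensorProduct

noncomputable section

variable (K : Type*) [Field K]
variable (A : Type*) [Ring A] [Algebra K A]

/-- Leibniz rules for a double-bracket-type operation. -/
def LeibnizRules (D : A ⊗[K] A →ₗ[K] A ⊗[K] A) : Prop :=
  (∀ a b c : A,
      D (a ⊗ₜ[K] (b * c)) =
        (b ⊗ₜ[K] (1 : A)) * D (a ⊗ₜ[K] c) + D (a ⊗ₜ[K] b) * ((1 : A) ⊗ₜ[K] c))
  ∧ (∀ a b c : A,
      D ((a * b) ⊗ₜ[K] c) =
        ((1 : A) ⊗ₜ[K] a) * D (b ⊗ₜ[K] c) + D (a ⊗ₜ[K] c) * (b ⊗ₜ[K] (1 : A)))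

/-- The associated bracket `{a,b} = m(⟪a,b⟫)`. -/
def br (D : A ⊗[K] A →ₗ[K] A ⊗[K] A) (a b : A) : A :=
  LinearMap.mul' K A (D (a ⊗ₜ[K] b))

/-- The K-span of commutators `[A,A]`. -/
def commutatorSpan : Submodule K A :=
  Submodule.span K {x : A | ∃ a b : A, x = a * b - b * a}

/-- The flip on `A ⊗ A`. -/
def flipT : A ⊗[K] A →ₗ[K] A ⊗[K] A := (TensorProduct.comm K A A).toLinearMap

/-- Swap of the last two tensor factors of `(A ⊗ A) ⊗ A`. -/
def swap23 : ((A ⊗[K] A) ⊗[K] A) →ₗ[K] ((A ⊗[K] A) ⊗[K] A) :=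
  (TensorProduct.assoc K A A A).symm.toLinearMap ∘ₗ
    (LinearMap.lTensor A (TensorProduct.comm K A A).toLinearMap) ∘ₗ
    (TensorProduct.assoc K A A A).toLinearMap

/-- `⟪a, -⟫_L` on double tensors: `b ⊗ c ↦ ⟪a,b⟫ ⊗ c`. -/
def dL (D : A ⊗[K] A →ₗ[K] A ⊗[K] A) (a : A) :
    A ⊗[K] A →ₗ[K] (A ⊗[K] A) ⊗[K] A :=
  LinearMap.rTensor A (D ∘ₗ TensorProduct.mk K A A a)

/-- `⟪a, -⟫_R` on double tensors: `b ⊗ c ↦ b ⊗ ⟪a,c⟫`. -/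
def dR (D : A ⊗[K] A →ₗ[K] A ⊗[K] A) (a : A) :
    A ⊗[K] A →ₗ[K] (A ⊗[K] A) ⊗[K] A :=
  (TensorProduct.assoc K A A A).symm.toLinearMap ∘ₗ
    LinearMap.lTensor A (D ∘ₗ TensorProduct.mk K A A a)

/-- `⟪-, c⟫_L` on double tensors: `b ⊗ b' ↦ ⟪b,c⟫' ⊗ b' ⊗ ⟪b,c⟫''`. -/
def dLfst (D : A ⊗[K] A →ₗ[K] A ⊗[K] A) (c : A) :
    A ⊗[K] A →ₗ[K] (A ⊗[K] A) ⊗[K] A :=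
  swap23 K A ∘ₗ LinearMap.rTensor A (D ∘ₗ (TensorProduct.mk K A A).flip c)

/-- The double Jacobiator. -/
def DJac (D : A ⊗[K] A →ₗ[K] A ⊗[K] A) (a b c : A) : (A ⊗[K] A) ⊗[K] A :=
  dL K A D a (D (b ⊗ₜ[K] c)) - dR K A D b (D (a ⊗ₜ[K] c)) - dLfst K A D c (D (a ⊗ₜ[K] b))

/-- `c ⊗₁ (-)` : `w' ⊗ w'' ↦ w' ⊗ c ⊗ w''`. -/
def otimes1 (c : A) : A ⊗[K] A →ₗ[K] (A ⊗[K] A) ⊗[K] A :=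
  LinearMap.rTensor A ((TensorProduct.mk K A A).flip c)

variable {ι : Type*}

/-- Mixed double algebra structure of weight `lam` with respect to the generators `v`. -/
def IsMixedDouble (v : ι → A) (lam : ι → K) (D : A ⊗[K] A →ₗ[K] A ⊗[K] A) : Prop :=
  LeibnizRules K A D ∧
  ∀ i j : ι,
    D (v i ⊗ₜ[K] v j) + flipT K A (D (v j ⊗ₜ[K] v i)) =
      ((lam i + lam j) / 2) • (v i ⊗ₜ[K] v j - v j ⊗ₜ[K] v i) +
      ((lam i - lam j) / 2) • ((1 : A) ⊗ₜ[K] (v i * v j) - (v j * v i) ⊗ₜ[K] (1 : A))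

/-- Mixed double Poisson algebra structure of weight `lam` w.r.t. the generators `v`. -/
def IsMixedDoublePoisson (v : ι → A) (lam : ι → K) (D : A ⊗[K] A →ₗ[K] A ⊗[K] A) : Prop :=
  IsMixedDouble K A v lam D ∧
  ∀ i j k : ι,
    DJac K A D (v i) (v j) (v k) =
      (-((lam i + lam j) / 2)) • otimes1 K A (v j) (D (v i ⊗ₜ[K] v k)) +
      ((lam i - lam j) / 2) •
        otimes1 K A (1 : A) (((1 : A) ⊗ₜ[K] v j) * D (v i ⊗ₜ[K] v k))

/-- Modified double Poisson bracket. -/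
def IsModifiedDoublePoisson (D : A ⊗[K] A →ₗ[K] A ⊗[K] A) : Prop :=
  LeibnizRules K A D ∧
  (∀ a b : A, br K A D a b + br K A D b a ∈ commutatorSpan K A) ∧
  (∀ a b c : A,
    br K A D a (br K A D b c) - br K A D b (br K A D a c) - br K A D (br K A D a b) c = 0)

end


namespace MDP

section
variable {K : Type*} [Field K] {A : Type*} [Ring A] [Algebra K A]
variable (D : A ⊗[K] A →ₗ[K] A ⊗[K] A)

/-- `x ⊗ y ↦ x ⊗ 1 ⊗ y` as an algebra map. -/
noncomputable def e13 : A ⊗[K] A →ₐ[K] (A ⊗[K] A) ⊗[K] A :=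
  Algebra.TensorProduct.map Algebra.TensorProduct.includeLeft (AlgHom.id K A)

/-- `x ⊗ y ↦ 1 ⊗ x ⊗ y` as an algebra map. -/
noncomputable def e23 : A ⊗[K] A →ₐ[K] (A ⊗[K] A) ⊗[K] A :=
  Algebra.TensorProduct.map Algebra.TensorProduct.includeRight (AlgHom.id K A)

/-- Triple multiplication. -/
noncomputable def m3 : (A ⊗[K] A) ⊗[K] A →ₗ[K] A :=
  LinearMap.mul' K A ∘ₗ LinearMap.rTensor A (LinearMap.mul' K A)

@[simp] lemma e13_tmul (x y : A) : e13 (K := K) (x ⊗ₜ[K] y) = (x ⊗ₜ[K] (1:A)) ⊗ₜ[K] y := by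
  simp [e13]
@[simp] lemma e23_tmul (x y : A) : e23 (K := K) (x ⊗ₜ[K] y) = ((1:A) ⊗ₜ[K] x) ⊗ₜ[K] y := by
  simp [e23]
@[simp] lemma m3_tmul (x y z : A) : m3 (K := K) ((x ⊗ₜ[K] y) ⊗ₜ[K] z) = x * y * z := by
  simp [m3]
@[simp] lemma swap23_tmul (x y z : A) :
    swap23 K A ((x ⊗ₜ[K] y) ⊗ₜ[K] z) = (x ⊗ₜ[K] z) ⊗ₜ[K] y := by
  simp [swap23]
@[simp] lemma dL_tmul (a b c : A) : dL K A D a (b ⊗ₜ[K] c) = D (a ⊗ₜ[K] b) ⊗ₜ[K] c := by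
  simp [dL]
@[simp] lemma dR_tmul (a b c : A) : dR K A D a (b ⊗ₜ[K] c) =
    (TensorProduct.assoc K A A A).symm (b ⊗ₜ[K] D (a ⊗ₜ[K] c)) := by
  simp [dR]
@[simp] lemma dLfst_tmul (a b c : A) : dLfst K A D c (a ⊗ₜ[K] b) =
    swap23 K A (D (a ⊗ₜ[K] c) ⊗ₜ[K] b) := by
  simp [dLfst]
@[simp] lemma otimes1_tmul (a b c : A) : otimes1 K A c (a ⊗ₜ[K] b) =
    (a ⊗ₜ[K] c) ⊗ₜ[K] b := by
  simp [otimes1]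
@[simp] lemma flipT_tmul (a b : A) : flipT K A (a ⊗ₜ[K] b) = b ⊗ₜ[K] a := by
  simp [flipT]

variable {D}

lemma D_one_right (hL : LeibnizRules K A D) (a : A) : D (a ⊗ₜ[K] (1:A)) = 0 := by
  have h := hL.1 a 1 1
  rw [mul_one, ← Algebra.TensorProduct.one_def, one_mul, mul_one] at h
  simpa using h

lemma D_one_left (hL : LeibnizRules K A D) (a : A) : D ((1:A) ⊗ₜ[K] a) = 0 := by
  have h := hL.2 1 1 a
  rw [mul_one, ← Algebra.TensorProduct.one_def, one_mul, mul_one] at h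
  simpa using h

lemma L1 (a b : A) (x : A ⊗[K] A) : dL K A D a (((1:A) ⊗ₜ[K] b) * x) =
    ((1:A ⊗[K] A) ⊗ₜ[K] b) * dL K A D a x := by
  induction x with
  | zero => simp
  | add x y hx hy => simp only [mul_add, map_add, hx, hy]
  | tmul p q => simp

lemma L2 (hL : LeibnizRules K A D) (a b : A) (x : A ⊗[K] A) : dL K A D a (x * (b ⊗ₜ[K] (1:A))) =
    dL K A D a x * (((1:A) ⊗ₜ[K] b) ⊗ₜ[K] (1:A)) + e13 x * (D (a ⊗ₜ[K] b) ⊗ₜ[K] (1:A)) := by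
  induction x with
  | zero => simp
  | add x y hx hy => simp only [mul_add, add_mul, map_add, hx, hy]; abel
  | tmul p q => simp [hL.1, add_tmul, add_comm]

lemma L3 (hL : LeibnizRules K A D) (a b : A) (x : A ⊗[K] A) : dL K A D (a * b) x =
    (((1:A) ⊗ₜ[K] a) ⊗ₜ[K] (1:A)) * dL K A D b x +
     dL K A D a x * ((b ⊗ₜ[K] (1:A)) ⊗ₜ[K] (1:A)) := by
  induction x with
  | zero => simp
  | add x y hx hy => simp only [mul_add, add_mul, map_add, hx, hy]; abel
  | tmul p q => simp [hL.2, add_tmul]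

lemma R1 (hL : LeibnizRules K A D) (a b : A) (x : A ⊗[K] A) : dR K A D (a * b) x =
    ((1:A ⊗[K] A) ⊗ₜ[K] a) * dR K A D b x +
     dR K A D a x * (((1:A) ⊗ₜ[K] b) ⊗ₜ[K] (1:A)) := by
  induction x with
  | zero => simp
  | add x y hx hy => simp only [mul_add, add_mul, map_add, hx, hy]; abel
  | tmul p q =>
    simp only [dR_tmul, hL.2, tmul_add, map_add]
    congr 1
    · generalize D (b ⊗ₜ[K] q) = w
      induction w with
      | zero => simp
      | add x y hx hy => simp only [mul_add, tmul_add, map_add, hx, hy]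
      | tmul r s => simp
    · generalize D (a ⊗ₜ[K] q) = w
      induction w with
      | zero => simp
      | add x y hx hy => simp only [add_mul, tmul_add, map_add, hx, hy]
      | tmul r s => simp

lemma R2 (hL : LeibnizRules K A D) (a b : A) (x : A ⊗[K] A) : dR K A D b (((1:A) ⊗ₜ[K] a) * x) =
    (((1:A) ⊗ₜ[K] a) ⊗ₜ[K] (1:A)) * dR K A D b x + e23 (D (b ⊗ₜ[K] a)) * e13 x := by
  induction x with
  | zero => simp
  | add x y hx hy => simp only [mul_add, map_add, hx, hy]; abel
  | tmul p q =>
    simp only [Algebra.TensorProduct.tmul_mul_tmul, one_mul, dR_tmul, hL.1, tmul_add, map_add]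
    congr 1
    · generalize D (b ⊗ₜ[K] q) = w
      induction w with
      | zero => simp
      | add x y hx hy => simp only [mul_add, tmul_add, map_add, hx, hy]
      | tmul r s => simp
    · generalize D (b ⊗ₜ[K] a) = w
      induction w with
      | zero => simp
      | add x y hx hy => simp only [add_mul, tmul_add, map_add, hx, hy]
      | tmul r s => simp

lemma R3 (a b : A) (x : A ⊗[K] A) : dR K A D b (x * (a ⊗ₜ[K] (1:A))) =
    dR K A D b x * ((a ⊗ₜ[K] (1:A)) ⊗ₜ[K] (1:A)) := by
  induction x with
  | zero => simp
  | add x y hx hy => simp only [add_mul, map_add, hx, hy]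
  | tmul p q =>
    simp only [Algebra.TensorProduct.tmul_mul_tmul, mul_one, dR_tmul]
    generalize D (b ⊗ₜ[K] q) = w
    induction w with
    | zero => simp
    | add x y hx hy => simp only [add_mul, tmul_add, map_add, hx, hy]
    | tmul r s => simp

lemma F1 (hL : LeibnizRules K A D) (b c : A) (x : A ⊗[K] A) : dLfst K A D c ((b ⊗ₜ[K] (1:A)) * x) =
    ((1:A ⊗[K] A) ⊗ₜ[K] b) * dLfst K A D c x + e13 (D (b ⊗ₜ[K] c)) * (x ⊗ₜ[K] (1:A)) := by
  induction x with
  | zero => simp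
  | add x y hx hy => simp only [mul_add, add_tmul, map_add, hx, hy]; abel
  | tmul p q =>
    simp only [Algebra.TensorProduct.tmul_mul_tmul, one_mul, dLfst_tmul, hL.2, add_tmul, map_add]
    congr 1
    · generalize D (p ⊗ₜ[K] c) = w
      induction w with
      | zero => simp
      | add x y hx hy => simp only [mul_add, add_tmul, map_add, hx, hy]
      | tmul r s => simp
    · generalize D (b ⊗ₜ[K] c) = w
      induction w with
      | zero => simp
      | add x y hx hy => simp only [add_mul, add_tmul, map_add, hx, hy]
      | tmul r s => simp

lemma F2 (b c : A) (x : A ⊗[K] A) : dLfst K A D c (x * ((1:A) ⊗ₜ[K] b)) =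
    dLfst K A D c x * (((1:A) ⊗ₜ[K] b) ⊗ₜ[K] (1:A)) := by
  induction x with
  | zero => simp
  | add x y hx hy => simp only [add_mul, map_add, hx, hy]
  | tmul p q =>
    simp only [Algebra.TensorProduct.tmul_mul_tmul, mul_one, dLfst_tmul]
    generalize D (p ⊗ₜ[K] c) = w
    induction w with
    | zero => simp
    | add x y hx hy => simp only [add_mul, add_tmul, map_add, hx, hy]
    | tmul r s => simp

lemma F3 (b c : A) (x : A ⊗[K] A) : dLfst K A D c (((1:A) ⊗ₜ[K] b) * x) =
    (((1:A) ⊗ₜ[K] b) ⊗ₜ[K] (1:A)) * dLfst K A D c x := by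
  induction x with
  | zero => simp
  | add x y hx hy => simp only [mul_add, map_add, hx, hy]
  | tmul p q =>
    simp only [Algebra.TensorProduct.tmul_mul_tmul, one_mul, dLfst_tmul]
    generalize D (p ⊗ₜ[K] c) = w
    induction w with
    | zero => simp
    | add x y hx hy => simp only [mul_add, add_tmul, map_add, hx, hy]
    | tmul r s => simp

lemma F4 (hL : LeibnizRules K A D) (b c : A) (x : A ⊗[K] A) : dLfst K A D c (x * (b ⊗ₜ[K] (1:A))) =
    dLfst K A D c x * ((b ⊗ₜ[K] (1:A)) ⊗ₜ[K] (1:A)) +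
      e23 (flipT K A x) * e13 (D (b ⊗ₜ[K] c)) := by
  induction x with
  | zero => simp
  | add x y hx hy => simp only [add_mul, map_add, hx, hy]; abel
  | tmul p q =>
    simp only [Algebra.TensorProduct.tmul_mul_tmul, mul_one, dLfst_tmul, hL.2, add_tmul, map_add]
    rw [add_comm]
    congr 1
    · generalize D (p ⊗ₜ[K] c) = w
      induction w with
      | zero => simp
      | add x y hx hy => simp only [add_mul, add_tmul, map_add, hx, hy]
      | tmul r s => simp
    · generalize D (b ⊗ₜ[K] c) = w
      induction w with
      | zero => simp
      | add x y hx hy => simp only [mul_add, add_tmul, map_add, hx, hy]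
      | tmul r s => simp

/-- Symmetrization. -/
noncomputable def E (D : A ⊗[K] A →ₗ[K] A ⊗[K] A) (a b : A) : A ⊗[K] A :=
  D (a ⊗ₜ[K] b) + flipT K A (D (b ⊗ₜ[K] a))

lemma flip_mul (x y : A ⊗[K] A) : flipT K A (x * y) = flipT K A x * flipT K A y := by
  exact map_mul (Algebra.TensorProduct.comm K A A) x y

lemma E_right (hL : LeibnizRules K A D) (a b c : A) : E D a (b * c) =
    (b ⊗ₜ[K] (1:A)) * E D a c + E D a b * ((1:A) ⊗ₜ[K] c) := by
  simp only [E, hL.1, hL.2, map_add, flip_mul, flipT_tmul, mul_add, add_mul]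
  abel

lemma E_left (hL : LeibnizRules K A D) (a b c : A) : E D (a * b) c =
    ((1:A) ⊗ₜ[K] a) * E D b c + E D a c * (b ⊗ₜ[K] (1:A)) := by
  simp only [E, hL.1, hL.2, map_add, flip_mul, flipT_tmul, mul_add, add_mul]
  abel

lemma DJac_b (hL : LeibnizRules K A D) (a b b' c : A) : DJac K A D a (b * b') c =
    ((1:A ⊗[K] A) ⊗ₜ[K] b) * DJac K A D a b' c +
      DJac K A D a b c * (((1:A) ⊗ₜ[K] b') ⊗ₜ[K] (1:A)) := by
  simp only [DJac, hL.1 a, hL.2 b, map_add, L1, L2 hL, R1 hL, F1 hL, F2, mul_sub, sub_mul]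
  abel

lemma DJac_a (hL : LeibnizRules K A D) (a a' b c : A) : DJac K A D (a * a') b c =
    (((1:A) ⊗ₜ[K] a) ⊗ₜ[K] (1:A)) * DJac K A D a' b c +
      DJac K A D a b c * ((a' ⊗ₜ[K] (1:A)) ⊗ₜ[K] (1:A)) -
      e23 (E D b a) * e13 (D (a' ⊗ₜ[K] c)) := by
  simp only [DJac, E, hL.2 a, map_add, L3 hL, R2 hL, R3, F3, F4 hL, mul_sub, sub_mul, add_mul]
  abel

lemma br_mul_right (hL : LeibnizRules K A D) (a : A) (x : A ⊗[K] A) : br K A D a (LinearMap.mul' K A x) =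
    m3 (dL K A D a x) + m3 (dR K A D a x) := by
  unfold br
  induction x with
  | zero => simp
  | add x y hx hy => simp only [tmul_add, map_add, hx, hy]; abel
  | tmul p q =>
    simp only [LinearMap.mul'_apply, hL.1, map_add, dL_tmul, dR_tmul]
    rw [add_comm]
    congr 1
    · generalize D (a ⊗ₜ[K] p) = w
      induction w with
      | zero => simp
      | add x y hx hy => simp only [add_mul, add_tmul, map_add, hx, hy]
      | tmul r s => simp [mul_assoc]
    · generalize D (a ⊗ₜ[K] q) = w
      induction w with
      | zero => simp
      | add x y hx hy => simp only [mul_add, tmul_add, map_add, hx, hy]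
      | tmul r s => simp [mul_assoc]

lemma br_mul_left (hL : LeibnizRules K A D) (c : A) (x : A ⊗[K] A) : br K A D (LinearMap.mul' K A x) c =
    m3 (dLfst K A D c x) + m3 (dLfst K A D c (flipT K A x)) := by
  unfold br
  induction x with
  | zero => simp
  | add x y hx hy => simp only [add_tmul, map_add, hx, hy]; abel
  | tmul p q =>
    simp only [LinearMap.mul'_apply, hL.2, map_add, dLfst_tmul, flipT_tmul]
    rw [add_comm]
    congr 1
    · generalize D (p ⊗ₜ[K] c) = w
      induction w with
      | zero => simp
      | add x y hx hy => simp only [add_mul, add_tmul, map_add, hx, hy]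
      | tmul r s => simp [mul_assoc]
    · generalize D (q ⊗ₜ[K] c) = w
      induction w with
      | zero => simp
      | add x y hx hy => simp only [mul_add, add_tmul, map_add, hx, hy]
      | tmul r s => simp [mul_assoc]

lemma J_eq (hL : LeibnizRules K A D) (a b c : A) :
    br K A D a (br K A D b c) - br K A D b (br K A D a c) - br K A D (br K A D a b) c =
    m3 (DJac K A D a b c) - m3 (DJac K A D b a c) - m3 (dLfst K A D c (E D b a)) := by
  have e1 : br K A D b c = LinearMap.mul' K A (D (b ⊗ₜ[K] c)) := rfl
  have e2 : br K A D a c = LinearMap.mul' K A (D (a ⊗ₜ[K] c)) := rfl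
  have e3 : br K A D a b = LinearMap.mul' K A (D (a ⊗ₜ[K] b)) := rfl
  rw [e1, e2, e3, br_mul_right hL, br_mul_right hL, br_mul_left hL]
  simp only [DJac, E, map_add, map_sub]
  abel

lemma br_der (hL : LeibnizRules K A D) (a b c : A) : br K A D a (b * c) = b * br K A D a c + br K A D a b * c := by
  have h := br_mul_right hL a (b ⊗ₜ[K] c)
  unfold br at *
  rw [hL.1, map_add]
  congr 1
  · generalize D (a ⊗ₜ[K] c) = w
    induction w with
    | zero => simp
    | add x y hx hy => simp only [mul_add, map_add, hx, hy]
    | tmul r s => simp [mul_assoc]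
  · generalize D (a ⊗ₜ[K] b) = w
    induction w with
    | zero => simp
    | add x y hx hy => simp only [add_mul, map_add, hx, hy]
    | tmul r s => simp [mul_assoc]

lemma m3_otimes1 (u y : A ⊗[K] A) :
    m3 (e23 u * e13 y) = m3 (otimes1 K A (LinearMap.mul' K A u) y) := by
  induction y with
  | zero => simp
  | add x y hx hy => simp only [mul_add, map_add, hx, hy]
  | tmul p q =>
    induction u with
    | zero => simp [otimes1]
    | add x y hx hy =>
      simp only [add_mul, map_add, hx, hy, otimes1_tmul, tmul_add, add_tmul]
    | tmul r s => simp [mul_assoc]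

lemma m3_comm (X : (A ⊗[K] A) ⊗[K] A) (b : A) :
    m3 (X * (((1:A) ⊗ₜ[K] b) ⊗ₜ[K] (1:A))) = m3 (((1:A ⊗[K] A) ⊗ₜ[K] b) * X) := by
  induction X with
  | zero => simp
  | add x y hx hy => simp only [mul_add, add_mul, map_add, hx, hy]
  | tmul p q =>
    induction p with
    | zero => simp
    | add x y hx hy =>
      simp only [add_tmul, mul_add, add_mul, map_add, hx, hy]
    | tmul r s => simp [mul_assoc]

lemma m3_dLfst (p q c : A) : m3 (dLfst K A D c (p ⊗ₜ[K] q)) =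
    m3 (otimes1 K A q (D (p ⊗ₜ[K] c))) := by
  rw [dLfst_tmul]
  generalize D (p ⊗ₜ[K] c) = w
  induction w with
  | zero => simp
  | add x y hx hy => simp only [add_tmul, map_add, hx, hy]
  | tmul r s => simp

lemma phi_mul (hL : LeibnizRules K A D) (p r q c : A) : m3 (dLfst K A D c ((p * r) ⊗ₜ[K] q)) =
    m3 (dLfst K A D c (r ⊗ₜ[K] (q * p))) + m3 (dLfst K A D c (p ⊗ₜ[K] (r * q))) := by
  simp only [m3_dLfst, hL.2, map_add]
  congr 1
  · generalize D (r ⊗ₜ[K] c) = w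
    induction w with
    | zero => simp
    | add x y hx hy => simp only [mul_add, map_add, hx, hy]
    | tmul r s => simp [mul_assoc]
  · generalize D (p ⊗ₜ[K] c) = w
    induction w with
    | zero => simp
    | add x y hx hy => simp only [add_mul, map_add, hx, hy]
    | tmul r s => simp [mul_assoc]

lemma phi1 (hL : LeibnizRules K A D) (a c : A) (x : A ⊗[K] A) :
    m3 (dLfst K A D c (x * ((1:A) ⊗ₜ[K] a))) - m3 (dLfst K A D c ((a ⊗ₜ[K] (1:A)) * x)) =
    - m3 (dLfst K A D c (a ⊗ₜ[K] LinearMap.mul' K A x)) := by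
  induction x with
  | zero => simp
  | add x y hx hy =>
    simp only [mul_add, add_mul, map_add, tmul_add, neg_add, ← hx, ← hy]; abel
  | tmul p q =>
    simp only [Algebra.TensorProduct.tmul_mul_tmul, mul_one, one_mul, phi_mul hL,
      LinearMap.mul'_apply]
    abel

lemma phi2 (hL : LeibnizRules K A D) (b c : A) (x : A ⊗[K] A) :
    m3 (dLfst K A D c (flipT K A x * (b ⊗ₜ[K] (1:A)))) -
      m3 (dLfst K A D c (((1:A) ⊗ₜ[K] b) * flipT K A x)) =
    m3 (dLfst K A D c (b ⊗ₜ[K] LinearMap.mul' K A x)) := by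
  induction x with
  | zero => simp
  | add x y hx hy =>
    simp only [mul_add, add_mul, map_add, tmul_add, ← hx, ← hy]; abel
  | tmul p q =>
    simp only [flipT_tmul, Algebra.TensorProduct.tmul_mul_tmul, mul_one, one_mul, phi_mul hL,
      LinearMap.mul'_apply]
    abel

end

section
variable {K : Type*} [Field K] {ι : Type*}

lemma exists_u (lam : ι → K) : ∃ u : FreeAlgebra K ι →ₗ[K] FreeAlgebra K ι ⊗[K] FreeAlgebra K ι,
    (∀ a b, u (a * b) = ((1 : FreeAlgebra K ι) ⊗ₜ[K] a) * u b +
      u a * (b ⊗ₜ[K] (1 : FreeAlgebra K ι))) ∧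
    ∀ i, u (FreeAlgebra.ι K i) = (lam i / 2) •
      (FreeAlgebra.ι K i ⊗ₜ[K] (1 : FreeAlgebra K ι) +
        (1 : FreeAlgebra K ι) ⊗ₜ[K] FreeAlgebra.ι K i) := by
  let g : ι → Matrix (Fin 2) (Fin 2) (FreeAlgebra K ι ⊗[K] FreeAlgebra K ι) := fun i =>
    !![(1 : FreeAlgebra K ι) ⊗ₜ[K] FreeAlgebra.ι K i,
      (lam i / 2) • (FreeAlgebra.ι K i ⊗ₜ[K] (1 : FreeAlgebra K ι) +
        (1 : FreeAlgebra K ι) ⊗ₜ[K] FreeAlgebra.ι K i);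
      0, FreeAlgebra.ι K i ⊗ₜ[K] (1 : FreeAlgebra K ι)]
  let φ := FreeAlgebra.lift K g
  have hφ : ∀ i, φ (FreeAlgebra.ι K i) = g i := fun i => FreeAlgebra.lift_ι_apply g i
  have key : ∀ a : FreeAlgebra K ι, φ a 0 0 = (1 : FreeAlgebra K ι) ⊗ₜ[K] a ∧ φ a 1 0 = 0 ∧
      φ a 1 1 = a ⊗ₜ[K] (1 : FreeAlgebra K ι) := by
    intro a
    induction a using FreeAlgebra.induction with
    | grade0 r =>
      rw [AlgHom.commutes]
      simp [Matrix.algebraMap_matrix_apply, Algebra.algebraMap_eq_smul_one,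
        Algebra.TensorProduct.one_def, TensorProduct.smul_tmul']
    | grade1 i => rw [hφ]; simp [g]
    | mul a b ha hb =>
      obtain ⟨a1, a2, a3⟩ := ha
      obtain ⟨b1, b2, b3⟩ := hb
      simp [Matrix.mul_apply, a1, a2, a3, b1, b2, b3]
    | add a b ha hb =>
      obtain ⟨a1, a2, a3⟩ := ha
      obtain ⟨b1, b2, b3⟩ := hb
      simp [a1, a2, a3, b1, b2, b3, tmul_add, add_tmul]
  refine ⟨{ toFun := fun a => φ a 0 1, map_add' := by simp, map_smul' := by simp }, ?_, ?_⟩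
  · intro a b
    simp [Matrix.mul_apply, (key a).1, (key b).2.2]
  · intro i
    simp only [LinearMap.coe_mk, AddHom.coe_mk, hφ]
    simp [g]

/-- Induction principle for algebra generators. -/
def Gen (K : Type*) [Field K] {ι A : Type*} [Ring A] [Algebra K A] (v : ι → A) : Prop :=
  ∀ P : A → Prop, (∀ r, P (algebraMap K A r)) → (∀ i, P (v i)) →
    (∀ a b, P a → P b → P (a * b)) → (∀ a b, P a → P b → P (a + b)) → ∀ a, P a

theorem gind {A : Type*} [Ring A] [Algebra K A] {v : ι → A} (hg : Gen K v) {motive : A → Prop}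
    (grade0 : ∀ r, motive (algebraMap K A r)) (grade1 : ∀ i, motive (v i))
    (mul : ∀ a b, motive a → motive b → motive (a * b))
    (add : ∀ a b, motive a → motive b → motive (a + b)) (a : A) : motive a :=
  hg motive grade0 grade1 mul add a

theorem free_gen : Gen K (FreeAlgebra.ι K : ι → FreeAlgebra K ι) := by
  intro P h0 h1 h2 h3 a
  induction a using FreeAlgebra.induction with
  | grade0 r => exact h0 r
  | grade1 i => exact h1 i
  | mul a b ha hb => exact h2 a b ha hb
  | add a b ha hb => exact h3 a b ha hb

variable {A : Type*} [Ring A] [Algebra K A] {v : ι → A}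
variable {D : A ⊗[K] A →ₗ[K] A ⊗[K] A}
  {lam : ι → K}
  {u : A →ₗ[K] A ⊗[K] A}

lemma u_one (hu : ∀ a b, u (a * b) = ((1 : A) ⊗ₜ[K] a) * u b +
      u a * (b ⊗ₜ[K] (1 : A))) : u 1 = 0 := by
  have h := hu 1 1
  rw [mul_one, ← Algebra.TensorProduct.one_def, one_mul, mul_one] at h
  simpa using h

lemma u_alg (hu : ∀ a b, u (a * b) = ((1 : A) ⊗ₜ[K] a) * u b +
      u a * (b ⊗ₜ[K] (1 : A))) (r : K) : u (algebraMap K _ r) = 0 := by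
  rw [Algebra.algebraMap_eq_smul_one, map_smul, u_one hu, smul_zero]

lemma E_alg_right {A : Type*} [Ring A] [Algebra K A] {D : A ⊗[K] A →ₗ[K] A ⊗[K] A}
    (hL : LeibnizRules K A D) (a : A) (r : K) : E D a (algebraMap K A r) = 0 := by
  simp [E, Algebra.algebraMap_eq_smul_one, tmul_smul, ← smul_tmul', D_one_right hL, D_one_left hL]

lemma E_alg_left {A : Type*} [Ring A] [Algebra K A] {D : A ⊗[K] A →ₗ[K] A ⊗[K] A}
    (hL : LeibnizRules K A D) (a : A) (r : K) : E D (algebraMap K A r) a = 0 := by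
  simp [E, Algebra.algebraMap_eq_smul_one, tmul_smul, ← smul_tmul', D_one_right hL, D_one_left hL]

lemma E_add_right {A : Type*} [Ring A] [Algebra K A] (D : A ⊗[K] A →ₗ[K] A ⊗[K] A)
    (a b c : A) : E D a (b + c) = E D a b + E D a c := by
  simp only [E, tmul_add, add_tmul, map_add]; abel

lemma E_add_left {A : Type*} [Ring A] [Algebra K A] (D : A ⊗[K] A →ₗ[K] A ⊗[K] A)
    (a b c : A) : E D (a + b) c = E D a c + E D b c := by
  simp only [E, tmul_add, add_tmul, map_add]; abel

/-- Elements of the two tensor legs commute. -/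
lemma legs {A : Type*} [Ring A] [Algebra K A] (a b : A) :
    (a ⊗ₜ[K] (1:A)) * ((1:A) ⊗ₜ[K] b) = ((1:A) ⊗ₜ[K] b) * (a ⊗ₜ[K] (1:A)) := by simp

lemma mulL {A : Type*} [Ring A] [Algebra K A] (a b : A) :
    ((a * b) ⊗ₜ[K] (1:A)) = (a ⊗ₜ[K] (1:A)) * (b ⊗ₜ[K] (1:A)) := by simp

lemma mulR {A : Type*} [Ring A] [Algebra K A] (a b : A) :
    ((1:A) ⊗ₜ[K] (a * b)) = ((1:A) ⊗ₜ[K] a) * ((1:A) ⊗ₜ[K] b) := by simp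

lemma alg_legs {A : Type*} [Ring A] [Algebra K A] (r : K) :
    ((algebraMap K A r) ⊗ₜ[K] (1:A)) = algebraMap K (A ⊗[K] A) r ∧
    ((1:A) ⊗ₜ[K] (algebraMap K A r)) = algebraMap K (A ⊗[K] A) r := by
  simp [Algebra.algebraMap_eq_smul_one, tmul_smul, ← smul_tmul', Algebra.TensorProduct.one_def]

lemma alg_legs' {A : Type*} [Ring A] [Algebra K A] (r : K) :
    ((algebraMap K (A ⊗[K] A) r) ⊗ₜ[K] (1:A)) = algebraMap K ((A ⊗[K] A) ⊗[K] A) r ∧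
    ((1 : A ⊗[K] A) ⊗ₜ[K] (algebraMap K A r)) = algebraMap K ((A ⊗[K] A) ⊗[K] A) r := by
  simp [Algebra.algebraMap_eq_smul_one, tmul_smul, ← smul_tmul', Algebra.TensorProduct.one_def]

lemma E_formula (hg : Gen K v)
    (h : IsMixedDouble K (A) v lam D)
    (hu : ∀ a b, u (a * b) = ((1 : A) ⊗ₜ[K] a) * u b +
      u a * (b ⊗ₜ[K] (1 : A)))
    (hui : ∀ i, u (v i) = (lam i / 2) •
      (v i ⊗ₜ[K] (1 : A) +
        (1 : A) ⊗ₜ[K] v i)) (b a : A) :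
    E D b a = u b * ((1 : A) ⊗ₜ[K] a) - (a ⊗ₜ[K] (1 : A)) * u b +
      flipT K _ (u a) * (b ⊗ₜ[K] (1 : A)) -
      ((1 : A) ⊗ₜ[K] b) * flipT K _ (u a) := by
  obtain ⟨hL, hE⟩ := h
  induction b using (gind hg) generalizing a with
  | grade0 r =>
    rw [E_alg_left hL, u_alg hu, (alg_legs r).1, (alg_legs r).2, Algebra.commutes]
    simp
  | add b b' hb hb' =>
    rw [E_add_left, hb, hb']
    simp only [map_add, add_mul, mul_add, add_tmul, tmul_add]
    abel
  | mul b b' hb hb' =>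
    rw [E_left hL, hb, hb', hu, mulL b b', mulR b b']
    have e1 := legs (K := K) a b
    have e2 := legs (K := K) b' a
    generalize flipT K _ (u a) = w
    generalize u b = ub
    generalize u b' = ub'
    simp only [mul_add, mul_sub, add_mul, sub_mul]
    rw [mul_assoc ub, ← e2, ← mul_assoc _ _ ub', ← e1]
    simp only [mul_assoc]
    abel
  | grade1 i =>
    induction a using (gind hg) with
    | grade0 r =>
      rw [E_alg_right hL, u_alg hu, (alg_legs r).1, (alg_legs r).2, Algebra.commutes]
      simp
    | add b b' hb hb' =>
      rw [E_add_right, hb, hb']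
      simp only [map_add, add_mul, mul_add, add_tmul, tmul_add]
      abel
    | mul b b' hb hb' =>
      rw [E_right hL, hb, hb', hu, mulL b b', mulR b b']
      simp only [map_add, flip_mul, flipT_tmul]
      have e1 := legs (K := K) b (v i)
      have e2 := legs (K := K) (v i) b'
      generalize flipT K _ (u b) = w
      generalize flipT K _ (u b') = w'
      generalize u _ = ub
      simp only [mul_add, mul_sub, add_mul, sub_mul]
      rw [mul_assoc w, e2, ← mul_assoc _ _ w', e1]
      simp only [mul_assoc]
      abel
    | grade1 j =>
      have := hE i j
      unfold E
      rw [this, hui, hui]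
      simp only [map_smul, map_add, flipT_tmul, smul_mul_assoc, mul_smul_comm, add_mul, mul_add,
        Algebra.TensorProduct.tmul_mul_tmul, one_mul, mul_one]
      module

lemma mul'_flip {A : Type*} [Ring A] [Algebra K A] (x : A ⊗[K] A) :
    LinearMap.mul' K A (flipT K A x) - LinearMap.mul' K A x ∈ commutatorSpan K A := by
  induction x with
  | zero => simp
  | add x y hx hy =>
    have := add_mem hx hy
    simp only [map_add]
    convert this using 1
    abel
  | tmul p q =>
    simp only [flipT_tmul, LinearMap.mul'_apply]
    exact Submodule.subset_span ⟨q, p, rfl⟩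

lemma mul'_mid {A : Type*} [Ring A] [Algebra K A] (x : A ⊗[K] A) (b : A) :
    LinearMap.mul' K A (x * (b ⊗ₜ[K] (1:A))) = LinearMap.mul' K A (((1:A) ⊗ₜ[K] b) * x) := by
  induction x with
  | zero => simp
  | add x y hx hy => simp only [add_mul, mul_add, map_add, hx, hy]
  | tmul p q => simp [mul_assoc]

lemma mul'_out {A : Type*} [Ring A] [Algebra K A] (x : A ⊗[K] A) (b : A) :
    LinearMap.mul' K A (x * ((1:A) ⊗ₜ[K] b)) = LinearMap.mul' K A x * b ∧
    LinearMap.mul' K A ((b ⊗ₜ[K] (1:A)) * x) = b * LinearMap.mul' K A x := by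
  induction x with
  | zero => simp
  | add x y hx hy => simp only [add_mul, mul_add, map_add, hx, hy, and_self]
  | tmul p q => simp [mul_assoc]

lemma DJac_formula_i (hg : Gen K v)
    (h : IsMixedDoublePoisson K (A) v lam D)
    (hu : ∀ a b, u (a * b) = ((1 : A) ⊗ₜ[K] a) * u b +
      u a * (b ⊗ₜ[K] (1 : A)))
    (hui : ∀ i, u (v i) = (lam i / 2) •
      (v i ⊗ₜ[K] (1 : A) +
        (1 : A) ⊗ₜ[K] v i)) (i k : ι) (b : A) :
    DJac K _ D (v i) b (v k) =
      ((1 : A ⊗[K] A) ⊗ₜ[K] b) * ((lam i / 2) • e13 (D (v i ⊗ₜ[K] v k))) -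
      ((lam i / 2) • e13 (D (v i ⊗ₜ[K] v k))) * (((1 : A) ⊗ₜ[K] b) ⊗ₜ[K] (1 : A)) -
      e23 (u b) * e13 (D (v i ⊗ₜ[K] v k)) := by
  obtain ⟨⟨hL, hE⟩, hJ⟩ := h
  have comm : ∀ (y : A ⊗[K] A) (b : A),
      e13 y * (((1 : A) ⊗ₜ[K] b) ⊗ₜ[K] (1 : A)) =
      (((1 : A) ⊗ₜ[K] b) ⊗ₜ[K] (1 : A)) * e13 y := by
    intro y b
    induction y with
    | zero => simp
    | add x y hx hy => simp only [add_mul, mul_add, map_add, hx, hy]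
    | tmul p q => simp
  induction b using (gind hg) with
  | grade0 r =>
    rw [u_alg hu]
    have : DJac K _ D (v i) (algebraMap K (A) r) (v k)
        = 0 := by
      unfold DJac
      rw [Algebra.algebraMap_eq_smul_one]
      have : dR K _ D (r • (1 : A)) = 0 := by
        apply TensorProduct.ext'
        intro x y
        simp [tmul_smul, ← smul_tmul', D_one_left hL]
      rw [this]
      simp [tmul_smul, ← smul_tmul', D_one_right hL, D_one_left hL]
    rw [this, (alg_legs r).2]
    have e1 : algebraMap K (A ⊗[K] A) r ⊗ₜ[K] (1 : A) =
      algebraMap K _ r := (alg_legs' r).1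
    have e2 : (1 : A ⊗[K] A) ⊗ₜ[K] algebraMap K (A) r =
      algebraMap K _ r := (alg_legs' r).2
    rw [e1, e2, Algebra.commutes]
    simp
  | add b b' hb hb' =>
    have : DJac K _ D (v i) (b + b') (v k) =
      DJac K _ D (v i) b (v k) +
      DJac K _ D (v i) b' (v k) := by
      unfold DJac
      have : dR K _ D (b + b') = dR K _ D b + dR K _ D b' := by
        apply TensorProduct.ext'
        intro x y
        simp [tmul_add, add_tmul]
      rw [this]
      simp only [tmul_add, add_tmul, map_add, LinearMap.add_apply]
      abel
    rw [this, hb, hb']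
    simp only [map_add, add_mul, mul_add, add_tmul, tmul_add]
    abel
  | mul b b' hb hb' =>
    rw [DJac_b hL, hb, hb', hu]
    have f1 : ((1 : A) ⊗ₜ[K] (b * b')) ⊗ₜ[K] (1 : A) =
      (((1 : A) ⊗ₜ[K] b) ⊗ₜ[K] (1 : A)) *
      (((1 : A) ⊗ₜ[K] b') ⊗ₜ[K] (1 : A)) := by simp
    have f2 : (1 : A ⊗[K] A) ⊗ₜ[K] (b * b') =
      ((1 : A ⊗[K] A) ⊗ₜ[K] b) *
      ((1 : A ⊗[K] A) ⊗ₜ[K] b') := by simp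
    rw [f1, f2]
    have g1 : e23 ((1 : A) ⊗ₜ[K] b) =
      (1 : A ⊗[K] A) ⊗ₜ[K] b := by
      simp [Algebra.TensorProduct.one_def]
    have c1 := comm (D (v i ⊗ₜ[K] v k)) b'
    simp only [map_add, map_mul, g1, e23_tmul]
    generalize e13 (D (v i ⊗ₜ[K] v k)) = y at *
    simp only [mul_add, mul_sub, add_mul, sub_mul, smul_mul_assoc,
      mul_smul_comm, mul_assoc, c1]
    module
  | grade1 j =>
    rw [hJ i j k, hui]
    generalize D (v i ⊗ₜ[K] v k) = y
    generalize v j = v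
    induction y with
    | zero => simp
    | add x y hx hy =>
      simp only [mul_add, add_mul, map_add, smul_add, neg_add] at hx hy ⊢
      linear_combination (norm := module) hx + hy
    | tmul p q =>
      simp only [otimes1_tmul, Algebra.TensorProduct.tmul_mul_tmul, one_mul, mul_one, e13_tmul,
        e23_tmul, map_smul, map_add, smul_mul_assoc, mul_smul_comm, add_mul]
      module

lemma e13_comm (y : A ⊗[K] A) (b : A) :
    e13 y * (((1 : A) ⊗ₜ[K] b) ⊗ₜ[K] (1 : A)) = (((1 : A) ⊗ₜ[K] b) ⊗ₜ[K] (1 : A)) * e13 y := by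
  induction y with
  | zero => simp
  | add x y hx hy => simp only [add_mul, mul_add, map_add, hx, hy]
  | tmul p q => simp

lemma DJac_add_a (a a' b c : A) :
    DJac K A D (a + a') b c = DJac K A D a b c + DJac K A D a' b c := by
  unfold DJac
  have : dL K A D (a + a') = dL K A D a + dL K A D a' := by
    apply TensorProduct.ext'
    intro x y
    simp [add_tmul]
  rw [this]
  simp only [add_tmul, map_add, LinearMap.add_apply]
  abel

lemma DJac_alg_a (hL : LeibnizRules K A D) (r : K) (b c : A) :
    DJac K A D (algebraMap K A r) b c = 0 := by
  unfold DJac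
  rw [Algebra.algebraMap_eq_smul_one]
  have : dL K A D (r • (1 : A)) = 0 := by
    apply TensorProduct.ext'
    intro x y
    simp [← smul_tmul', D_one_left hL]
  rw [this]
  simp [← smul_tmul', D_one_left hL]

lemma mul_step {R : Type*} [Ring R] {P Q F b2 b3 X X' Y Y' ub w : R}
    (c1 : b3 * P = P * b3) (c2 : b2 * F = F * b2) (c3 : Y' * b2 = b2 * Y') :
    P * (b3 * X' - X' * b2 - ub * Y') + (b3 * X - X * b2 - ub * Y) * F -
      (ub * Q - P * ub + w * b2 - b3 * w) * Y' =
    b3 * (P * X' + X * F + w * Y') - (P * X' + X * F + w * Y') * b2 - ub * (Q * Y' + Y * F) := by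
  have c1' : ∀ z, b3 * (P * z) = P * (b3 * z) := fun z => by
    rw [← mul_assoc, c1, mul_assoc]
  simp only [mul_add, mul_sub, add_mul, sub_mul, mul_assoc, c1', c2, c3]
  abel

lemma DJac_formula (hg : Gen K v)
    (h : IsMixedDoublePoisson K A v lam D)
    (hu : ∀ a b, u (a * b) = ((1 : A) ⊗ₜ[K] a) * u b + u a * (b ⊗ₜ[K] (1 : A)))
    (hui : ∀ i, u (v i) = (lam i / 2) • (v i ⊗ₜ[K] (1 : A) + (1 : A) ⊗ₜ[K] v i))
    (k : ι) (a : A) : ∃ X : (A ⊗[K] A) ⊗[K] A, ∀ b : A,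
    DJac K A D a b (v k) =
      ((1 : A ⊗[K] A) ⊗ₜ[K] b) * X - X * (((1 : A) ⊗ₜ[K] b) ⊗ₜ[K] (1 : A)) -
      e23 (u b) * e13 (D (a ⊗ₜ[K] v k)) := by
  have hL := h.1.1
  induction a using (gind hg) with
  | grade0 r =>
    refine ⟨0, fun b => ?_⟩
    rw [DJac_alg_a hL, Algebra.algebraMap_eq_smul_one]
    simp [← smul_tmul', D_one_left hL]
  | grade1 i => exact ⟨_, fun b => DJac_formula_i hg h hu hui i k b⟩
  | add a a' ha ha' =>
    obtain ⟨X, hX⟩ := ha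
    obtain ⟨X', hX'⟩ := ha'
    refine ⟨X + X', fun b => ?_⟩
    rw [DJac_add_a, hX, hX']
    simp only [add_tmul, map_add, mul_add, add_mul]
    abel
  | mul a a' ha ha' =>
    obtain ⟨X, hX⟩ := ha
    obtain ⟨X', hX'⟩ := ha'
    refine ⟨(((1 : A) ⊗ₜ[K] a) ⊗ₜ[K] (1 : A)) * X' + X * ((a' ⊗ₜ[K] (1 : A)) ⊗ₜ[K] (1 : A)) +
      e23 (flipT K A (u a)) * e13 (D (a' ⊗ₜ[K] v k)), fun b => ?_⟩
    have g1 : e23 ((1 : A) ⊗ₜ[K] b) = (1 : A ⊗[K] A) ⊗ₜ[K] b := by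
      simp [Algebra.TensorProduct.one_def]
    have g2 : e13 ((1 : A) ⊗ₜ[K] a) = (1 : A ⊗[K] A) ⊗ₜ[K] a := by
      simp [Algebra.TensorProduct.one_def]
    have g3 : e23 ((1 : A) ⊗ₜ[K] a) = (1 : A ⊗[K] A) ⊗ₜ[K] a := by
      simp [Algebra.TensorProduct.one_def]
    rw [DJac_a hL, hX, hX', E_formula hg h.1 hu hui b a, hL.2]
    have k1 : e23 (u b * ((1 : A) ⊗ₜ[K] a) - (a ⊗ₜ[K] (1 : A)) * u b +
      flipT K A (u a) * (b ⊗ₜ[K] (1 : A)) - ((1 : A) ⊗ₜ[K] b) * flipT K A (u a)) =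
      e23 (u b) * ((1 : A ⊗[K] A) ⊗ₜ[K] a) - (((1 : A) ⊗ₜ[K] a) ⊗ₜ[K] (1 : A)) * e23 (u b) +
      e23 (flipT K A (u a)) * (((1 : A) ⊗ₜ[K] b) ⊗ₜ[K] (1 : A)) -
      ((1 : A ⊗[K] A) ⊗ₜ[K] b) * e23 (flipT K A (u a)) := by
      rw [map_sub, map_add, map_sub, map_mul, map_mul, map_mul, map_mul, g1, g3, e23_tmul, e23_tmul]
    have k2 : e13 (((1 : A) ⊗ₜ[K] a) * D (a' ⊗ₜ[K] v k) + D (a ⊗ₜ[K] v k) * (a' ⊗ₜ[K] (1 : A))) =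
      ((1 : A ⊗[K] A) ⊗ₜ[K] a) * e13 (D (a' ⊗ₜ[K] v k)) +
      e13 (D (a ⊗ₜ[K] v k)) * ((a' ⊗ₜ[K] (1 : A)) ⊗ₜ[K] (1 : A)) := by
      rw [map_add, map_mul, map_mul, g2, e13_tmul]
    rw [k1, k2]
    exact mul_step (by simp) (by simp) (e13_comm _ _)

lemma m3_DJac (hg : Gen K v)
    (h : IsMixedDoublePoisson K A v lam D)
    (hu : ∀ a b, u (a * b) = ((1 : A) ⊗ₜ[K] a) * u b + u a * (b ⊗ₜ[K] (1 : A)))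
    (hui : ∀ i, u (v i) = (lam i / 2) • (v i ⊗ₜ[K] (1 : A) + (1 : A) ⊗ₜ[K] v i))
    (k : ι) (a b : A) : m3 (DJac K A D a b (v k)) =
      - m3 (dLfst K A D (v k) (a ⊗ₜ[K] LinearMap.mul' K A (u b))) := by
  obtain ⟨X, hX⟩ := DJac_formula hg h hu hui k a
  rw [hX, map_sub, map_sub, m3_comm, sub_self, zero_sub, m3_otimes1, m3_dLfst]

theorem mixed_to_modified (hg : Gen K v)
    (h : IsMixedDoublePoisson K A v lam D)
    (hu : ∀ a b, u (a * b) = ((1 : A) ⊗ₜ[K] a) * u b + u a * (b ⊗ₜ[K] (1 : A)))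
    (hui : ∀ i, u (v i) = (lam i / 2) • (v i ⊗ₜ[K] (1 : A) + (1 : A) ⊗ₜ[K] v i)) :
    IsModifiedDoublePoisson K A D := by
  have hL := h.1.1
  refine ⟨hL, ?_, ?_⟩
  · intro a b
    have e := congrArg (LinearMap.mul' K A) (E_formula hg h.1 hu hui a b)
    rw [map_sub, map_add, map_sub, mul'_mid, add_sub_cancel_right, (mul'_out _ _).1,
      (mul'_out _ _).2] at e
    have e' : LinearMap.mul' K A (E D a b) ∈ commutatorSpan K A := by
      rw [e]; exact Submodule.subset_span ⟨_, _, rfl⟩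
    have := sub_mem e' (mul'_flip (D (b ⊗ₜ[K] a)))
    unfold E at this
    unfold br
    rw [map_add] at this
    convert this using 1
    abel
  · intro a b c
    have br_add : ∀ a b c : A, br K A D a (b + c) = br K A D a b + br K A D a c := by
      intro a b c; simp [br, tmul_add]
    have br_alg : ∀ (a : A) (r : K), br K A D a (algebraMap K A r) = 0 := by
      intro a r; simp [br, Algebra.algebraMap_eq_smul_one, tmul_smul, D_one_right hL]
    have br_zero : ∀ a : A, br K A D a 0 = 0 := by intro a; simp [br]
    induction c using (gind hg) with
    | grade0 r => simp [br_alg, br_zero]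
    | add c c' hc hc' =>
      have := congrArg₂ (· + ·) hc hc'
      simp only [br_add, add_zero] at this ⊢
      rw [← this]; abel
    | mul c c' hc hc' =>
      have : c * (br K A D a (br K A D b c') - br K A D b (br K A D a c')
          - br K A D (br K A D a b) c') + (br K A D a (br K A D b c) - br K A D b (br K A D a c)
          - br K A D (br K A D a b) c) * c' = 0 := by rw [hc, hc']; simp
      rw [← this]
      simp only [br_der hL, br_add, mul_sub, sub_mul]
      abel
    | grade1 k =>
      rw [J_eq hL, m3_DJac hg h hu hui, m3_DJac hg h hu hui, E_formula hg h.1 hu hui b a]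
      have p1 := phi1 hL a (v k) (u b)
      have p2 := phi2 hL b (v k) (u a)
      simp only [map_sub, map_add] at p1 p2 ⊢
      linear_combination (norm := module) - p1 - p2

end
end MDP

namespace MDP
section
variable {K : Type*} [Field K] {A : Type*} [Ring A] [Algebra K A] {d : ℕ} {v : Fin d → A}
  {D : A ⊗[K] A →ₗ[K] A ⊗[K] A}

theorem gen_check (h2 : (2 : K) ≠ 0) (δ : ℕ) (hL : LeibnizRules K A D)
    (H0 : ∀ i j : Fin d, (j : ℕ) ≤ i → D (v i ⊗ₜ[K] v j) = 0)
    (Hpp : ∀ i j : Fin d, (i : ℕ) < j → (j : ℕ) < δ →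
      D (v i ⊗ₜ[K] v j) = v i ⊗ₜ[K] v j - v j ⊗ₜ[K] v i)
    (Hpm : ∀ i j : Fin d, (i : ℕ) < δ → δ ≤ (j : ℕ) →
      D (v i ⊗ₜ[K] v j) = (1 : A) ⊗ₜ[K] (v i * v j) - (v j * v i) ⊗ₜ[K] (1 : A))
    (Hmm : ∀ i j : Fin d, (i : ℕ) < j → δ ≤ (i : ℕ) →
      D (v i ⊗ₜ[K] v j) = v j ⊗ₜ[K] v i - v i ⊗ₜ[K] v j) :
    IsMixedDoublePoisson K A v (fun i : Fin d => if (i : ℕ) < δ then (1 : K) else -1) D := by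
  have t1 : ((1 : K) + 1) / 2 = 1 := by rw [one_add_one_eq_two, div_self h2]
  have t2 : ((1 : K) - -1) / 2 = 1 := by rw [sub_neg_eq_add, one_add_one_eq_two, div_self h2]
  have t3 : (-(1 : K) - 1) / 2 = -1 := by
    rw [show -(1 : K) - 1 = -2 by ring, neg_div, div_self h2]
  have t4 : (-(1 : K) + -1) / 2 = -1 := by
    rw [show -(1 : K) + -1 = -2 by ring, neg_div, div_self h2]
  have o1 := D_one_right hL
  have o2 := D_one_left hL
  refine ⟨⟨hL, ?_⟩, ?_⟩
  · intro i j
    rcases lt_trichotomy (i : ℕ) j with hij | hij | hij <;>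
    by_cases hi : (i : ℕ) < δ <;> by_cases hj : (j : ℕ) < δ <;> (try omega) <;>
    simp (disch := omega) only [H0, Hpp, Hpm, Hmm, hi, hj, if_true, if_false, t1, t2, t3, t4,
      map_sub, map_zero, flipT_tmul] <;>
    first
    | (have hij' := Fin.ext hij
       subst hij'
       simp)
    | module
  · intro i j k
    unfold DJac
    rcases lt_trichotomy (i : ℕ) j with hij | hij | hij <;>
    rcases lt_trichotomy (i : ℕ) k with hik | hik | hik <;>
    rcases lt_trichotomy (j : ℕ) k with hjk | hjk | hjk <;>
    (try omega) <;>
    (try (have hij' := Fin.ext hij; subst hij')) <;>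
    (try (have hik' := Fin.ext hik; subst hik')) <;>
    (try (have hjk' := Fin.ext hjk; subst hjk')) <;>
    by_cases hi : (i : ℕ) < δ <;> (try by_cases hj : (j : ℕ) < δ) <;>
    (try by_cases hk : (k : ℕ) < δ) <;> (try omega) <;>
    simp (disch := omega) only [H0, Hpp, Hpm, Hmm, *, if_true, if_false, t1, t2, t3, t4,
      map_sub, map_zero, dL_tmul, dR_tmul, dLfst_tmul, hL.1, hL.2, o1, o2, sub_tmul, tmul_sub,
      add_tmul, tmul_add, map_add, swap23_tmul, TensorProduct.assoc_symm_tmul, otimes1_tmul,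
      mul_sub, sub_mul, Algebra.TensorProduct.tmul_mul_tmul, one_mul, mul_one, mul_zero, zero_mul,
      zero_tmul, tmul_zero, mul_add, add_mul, mul_assoc] <;>
    module
end
end MDP

theorem stmt18 {K : Type*} [Field K] [IsAlgClosed K] [CharZero K]
    {d : ℕ} (hd : 4 ≤ d) (δ : ℕ) (hδ : δ ≤ d)
    (D : FreeAlgebra K (Fin d) ⊗[K] FreeAlgebra K (Fin d) →ₗ[K] FreeAlgebra K (Fin d) ⊗[K] FreeAlgebra K (Fin d))
    (hL : LeibnizRules K (FreeAlgebra K (Fin d)) D)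
    (hdiag : ∀ i : Fin d, D (FreeAlgebra.ι K i ⊗ₜ[K] FreeAlgebra.ι K i) = 0)
    (h1 : ∀ i j : Fin d, i < j → (j : ℕ) < δ →
      D (FreeAlgebra.ι K i ⊗ₜ[K] FreeAlgebra.ι K j) =
          FreeAlgebra.ι K i ⊗ₜ[K] FreeAlgebra.ι K j - FreeAlgebra.ι K j ⊗ₜ[K] FreeAlgebra.ι K i ∧
        D (FreeAlgebra.ι K j ⊗ₜ[K] FreeAlgebra.ι K i) = 0)
    (h2 : ∀ i k : Fin d, (i : ℕ) < δ → δ ≤ (k : ℕ) →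
      D (FreeAlgebra.ι K i ⊗ₜ[K] FreeAlgebra.ι K k) =
          (1 : FreeAlgebra K (Fin d)) ⊗ₜ[K] (FreeAlgebra.ι K i * FreeAlgebra.ι K k) -
            (FreeAlgebra.ι K k * FreeAlgebra.ι K i) ⊗ₜ[K] (1 : FreeAlgebra K (Fin d)) ∧
        D (FreeAlgebra.ι K k ⊗ₜ[K] FreeAlgebra.ι K i) = 0)
    (h3 : ∀ k l : Fin d, k < l → δ ≤ (k : ℕ) →
      D (FreeAlgebra.ι K k ⊗ₜ[K] FreeAlgebra.ι K l) =
          -(FreeAlgebra.ι K k ⊗ₜ[K] FreeAlgebra.ι K l) + FreeAlgebra.ι K l ⊗ₜ[K] FreeAlgebra.ι K k ∧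
        D (FreeAlgebra.ι K l ⊗ₜ[K] FreeAlgebra.ι K k) = 0) :
    IsMixedDoublePoisson K (FreeAlgebra K (Fin d)) (FreeAlgebra.ι K)
        (fun i : Fin d => if (i : ℕ) < δ then (1 : K) else -1) D ∧
      IsModifiedDoublePoisson K (FreeAlgebra K (Fin d)) D := by
  have hg : MDP.Gen K (FreeAlgebra.ι K : Fin d → FreeAlgebra K (Fin d)) := MDP.free_gen
  have key : IsMixedDoublePoisson K (FreeAlgebra K (Fin d)) (FreeAlgebra.ι K)
        (fun i : Fin d => if (i : ℕ) < δ then (1 : K) else -1) D := by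
    refine MDP.gen_check two_ne_zero δ hL ?_ ?_ ?_ ?_
    · intro i j hij
      rcases Nat.lt_or_eq_of_le hij with h | h
      · by_cases hi : (i : ℕ) < δ
        · exact (h1 j i h hi).2
        · by_cases hj : (j : ℕ) < δ
          · exact (h2 j i hj (by omega)).2
          · exact (h3 j i h (by omega)).2
      · have h' := Fin.ext h
        subst h'
        exact hdiag _
    · intro i j hij hj
      exact (h1 i j hij hj).1
    · intro i j hi hj
      exact (h2 i j hi hj).1
    · intro i j hij hi
      rw [(h3 i j hij hi).1]
      exact neg_add_eq_sub _ _
  obtain ⟨u, hu, hui⟩ := MDP.exists_u (K := K)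
    (fun i : Fin d => if (i : ℕ) < δ then (1 : K) else -1)
  exact ⟨key, MDP.mixed_to_modified hg key hu hui⟩
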